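/- arXiv:2504.10722 — 2 statements merged into one kernel-verified Lean document; each statement's English description precedes it below -/
import Mathlib

section
/- Let D be an MCD-domain. Then D is a PSP-domain if and only if D is a GL-domain. -/
/-- A polynomial over `D` is primitive if every element of `D` dividing all of its
coefficients is a unit. -/
def IsPrimitivePoly {D : Type*} [CommRing D] (f : Polynomial D) : Prop :=
  ∀ d : D, (∀ n : ℕ, d ∣ f.coeff n) → IsUnit d

/-- `D` is a GL-domain if the product of any two primitive polynomials over `D` is
again primitive. -/
def IsGLDomain (D : Type*) [CommRing D] : Prop :=
  ∀ f g : Polynomial D, IsPrimitivePoly f → IsPrimitivePoly g → IsPrimitivePoly (f * g)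

/-- A nonzero polynomial `f` over `D` is super-primitive if every element `q` of the
fraction field of `D` such that `q * c` lies in (the image of) `D` for every
coefficient `c` of `f` must itself lie in (the image of) `D`. -/
def IsSuperPrimitivePoly {D : Type*} [CommRing D] [IsDomain D] (f : Polynomial D) : Prop :=
  ∀ q : FractionRing D,
    (∀ n : ℕ, ∃ d : D, q * algebraMap D (FractionRing D) (f.coeff n)
        = algebraMap D (FractionRing D) d) →
    ∃ d : D, q = algebraMap D (FractionRing D) d

/-- `D` is a PSP-domain if every (nonzero) primitive polynomial over `D` is
super-primitive. -/
def IsPSPDomain (D : Type*) [CommRing D] [IsDomain D] : Prop :=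
  ∀ f : Polynomial D, f ≠ 0 → IsPrimitivePoly f → IsSuperPrimitivePoly f

/-- `d` is a maximal common divisor of the finite set `S`: it is a common divisor of `S`
and every common divisor of `S` divisible by `d` is an associate of `d`. -/
def IsMCDOf {D : Type*} [CommRing D] (d : D) (S : Finset D) : Prop :=
  (∀ s ∈ S, d ∣ s) ∧ ∀ d' : D, (∀ s ∈ S, d' ∣ s) → d ∣ d' → Associated d d'

/-- `D` is an MCD-domain if every nonempty finite set of nonzero elements of `D`
has a maximal common divisor. -/
def IsMCDDomain (D : Type*) [CommRing D] : Prop :=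
  ∀ S : Finset D, S.Nonempty → (∀ s ∈ S, s ≠ 0) → ∃ d : D, IsMCDOf d S

open Polynomial in
/-- By McCoy's theorem modulo `d`: if `d` divides every coefficient of `f * g` but not every
coefficient of `g`, then some `r` not divisible by `d` multiplies every coefficient of `f`
into the ideal generated by `d`. -/
theorem exists_not_dvd_forall_dvd_mul_coeff {D : Type*} [CommRing D] {d : D} {f g : D[X]}
    (hfg : ∀ n, d ∣ (f * g).coeff n) (hg : ¬ ∀ n, d ∣ g.coeff n) :
    ∃ r : D, ¬ d ∣ r ∧ ∀ n, d ∣ r * f.coeff n := by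
  let φ := Ideal.Quotient.mk (Ideal.span {d})
  have hφ (x : D) : φ x = 0 ↔ d ∣ x := by
    rw [Ideal.Quotient.eq_zero_iff_mem, Ideal.mem_span_singleton]
  have hmap (p : D[X]) : p.map φ = 0 ↔ ∀ n, d ∣ p.coeff n := by
    simp [Polynomial.ext_iff, hφ]
  have hf : f.map φ ∉ nonZeroDivisors (D ⧸ Ideal.span {d})[X] := fun h =>
    hg <| (hmap g).1 <| (mul_left_mem_nonZeroDivisors_eq_zero_iff h).1 <| by
      rw [← Polynomial.map_mul, hmap]
      exact hfg
  obtain ⟨r, hr, hrf⟩ := Polynomial.notMem_nonZeroDivisors_iff.1 hf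
  obtain ⟨r, rfl⟩ := Ideal.Quotient.mk_surjective r
  refine ⟨r, fun h => hr ((hφ r).2 h), fun n => ?_⟩
  rw [← hφ, map_mul, ← coeff_map]
  simpa using congrArg (fun p => p.coeff n) hrf

theorem IsPrimitivePoly.ne_zero {D : Type*} [CommRing D] [Nontrivial D] {f : Polynomial D}
    (hf : IsPrimitivePoly f) : f ≠ 0 := by
  rintro rfl
  exact not_isUnit_zero (hf 0 fun _ => by simp)

/-- A super-primitive polynomial allows cancellation of its coefficients in divisibilities. -/
theorem IsSuperPrimitivePoly.dvd_of_forall_dvd_mul_coeff {D : Type*} [CommRing D] [IsDomain D]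
    {f : Polynomial D} (hf : IsSuperPrimitivePoly f) {d r : D} (hd : d ≠ 0)
    (h : ∀ n, d ∣ r * f.coeff n) : d ∣ r := by
  have hd' : algebraMap D (FractionRing D) d ≠ 0 := by simpa using hd
  obtain ⟨e, he⟩ := hf (algebraMap D _ r / algebraMap D _ d) fun n => by
    obtain ⟨c, hc⟩ := h n
    refine ⟨c, ?_⟩
    rw [div_mul_eq_mul_div, div_eq_iff hd', ← map_mul, ← map_mul, hc, mul_comm]
  refine ⟨e, IsFractionRing.injective D (FractionRing D) ?_⟩
  rw [map_mul, mul_comm, ← he, div_mul_cancel₀ _ hd']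

theorem IsPSPDomain.isGLDomain {D : Type*} [CommRing D] [IsDomain D] (h : IsPSPDomain D) :
    IsGLDomain D := by
  intro f g hf hg d hd
  by_contra hu
  obtain ⟨r, hr, hrf⟩ := exists_not_dvd_forall_dvd_mul_coeff hd fun hdg => hu (hg d hdg)
  have hd0 : d ≠ 0 := by
    rintro rfl
    refine mul_ne_zero hf.ne_zero hg.ne_zero (Polynomial.ext fun n => ?_)
    simpa using hd n
  exact hr ((h f hf.ne_zero hf).dvd_of_forall_dvd_mul_coeff hd0 hrf)

/-- In an MCD-domain, two nonzero elements become coprime after dividing both by a suitable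
nonzero common divisor. -/
theorem IsMCDDomain.exists_isRelPrime {D : Type*} [CommRing D] [IsDomain D]
    (h : IsMCDDomain D) {a b : D} (ha : a ≠ 0) (hb : b ≠ 0) :
    ∃ d a' b' : D, d ≠ 0 ∧ a = d * a' ∧ b = d * b' ∧ IsRelPrime a' b' := by
  classical
  obtain ⟨d, hd, hmax⟩ := h {a, b} (by simp) (by simp [ha, hb])
  obtain ⟨a', rfl⟩ := hd a (by simp)
  obtain ⟨b', rfl⟩ := hd b (by simp)
  have hd0 : d ≠ 0 := left_ne_zero_of_mul ha
  refine ⟨d, a', b', hd0, rfl, rfl, fun e hea heb => ?_⟩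
  have hass := hmax (d * e) (by simp [mul_dvd_mul_left, hea, heb]) (dvd_mul_right d e)
  obtain ⟨c, hc⟩ := hass.symm.dvd
  exact IsUnit.of_mul_eq_one c (mul_left_cancel₀ hd0 (by rw [mul_one, ← mul_assoc, ← hc]))

open Polynomial in
theorem IsGLDomain.isUnit_of_isRelPrime {D : Type*} [CommRing D] (h : IsGLDomain D)
    {f : D[X]} (hf : IsPrimitivePoly f) {a b : D} (hab : IsRelPrime a b)
    (hdvd : ∀ n, b ∣ a * f.coeff n) : IsUnit b := by
  have hlin : IsPrimitivePoly (C a + X * C b) := fun d hd =>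
    hab (by simpa using hd 0) (by simpa [coeff_C] using hd 1)
  refine h _ _ hlin hf b fun n => ?_
  rw [add_mul, mul_assoc, coeff_add, coeff_C_mul]
  refine dvd_add (hdvd n) ?_
  cases n with
  | zero => simp
  | succ n => simp

theorem IsGLDomain.isPSPDomain {D : Type*} [CommRing D] [IsDomain D] (h : IsGLDomain D)
    (hMCD : IsMCDDomain D) : IsPSPDomain D := by
  intro f _ hf q hq
  obtain ⟨a, b, hb, rfl⟩ := IsFractionRing.div_surjective (A := D) q
  have hb0 : b ≠ 0 := nonZeroDivisors.ne_zero hb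
  rcases eq_or_ne a 0 with rfl | ha0
  · exact ⟨0, by simp⟩
  obtain ⟨d, a, b, hd0, rfl, rfl, hab⟩ := hMCD.exists_isRelPrime ha0 hb0
  have hb' : algebraMap D (FractionRing D) b ≠ 0 := by
    simpa using right_ne_zero_of_mul hb0
  have hd' : algebraMap D (FractionRing D) d ≠ 0 := by simpa using hd0
  simp only [map_mul, mul_div_mul_left _ _ hd'] at hq ⊢
  have hunit : IsUnit b := h.isUnit_of_isRelPrime hf hab fun n => by
    obtain ⟨e, he⟩ := hq n
    refine ⟨e, IsFractionRing.injective D (FractionRing D) ?_⟩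
    rw [div_mul_eq_mul_div, div_eq_iff hb'] at he
    rw [map_mul, map_mul, he, mul_comm]
  obtain ⟨c, hc⟩ := hunit.dvd (a := a)
  exact ⟨c, by rw [div_eq_iff hb', ← map_mul, mul_comm, ← hc]⟩

theorem stmt4 {D : Type*} [CommRing D] [IsDomain D] (hMCD : IsMCDDomain D) :
    IsPSPDomain D ↔ IsGLDomain D :=
  ⟨IsPSPDomain.isGLDomain, fun h => h.isPSPDomain hMCD⟩
end

section
/- Let R₀ = 𝔽₂[M] where M = ℚ≥0 × ℚ≥0 × ℚ≥0 × (ℕ → ℚ≥0), and let R be the 𝔽₂-subalgebra of R₀ generated by the monomials X^α, Y^α, Z^α for α ∈ ℚ≥0 together with all monomials X^α ∏_i T_i^{t(i)}, Y^α ∏_i T_i^{t(i)}, Z^α ∏_i T_i^{t(i)} with α ∈ ℚ, α > 0, and t : ℕ → ℚ≥0. Then the polynomial ring R[x] is not an IDF domain. -/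
/-- The additive monoid `ℚ≥0 × ℚ≥0 × ℚ≥0 × (ℕ → ℚ≥0)` of exponents of the monomials
`X^a Y^b Z^c ∏_i T_i^(t i)`. -/
abbrev ExpMonoid : Type := ℚ≥0 × ℚ≥0 × ℚ≥0 × (ℕ → ℚ≥0)

/-- The monoid algebra `R₀ = 𝔽₂[ExpMonoid]`. -/
abbrev RZero : Type := AddMonoidAlgebra (ZMod 2) ExpMonoid

/-- The generating monomials of `R`: the monomials `X^α`, `Y^α`, `Z^α` for `α ∈ ℚ≥0`,
together with the monomials `X^α ∏_i T_i^(t i)`, `Y^α ∏_i T_i^(t i)`, `Z^α ∏_i T_i^(t i)`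
for a positive rational `α` and `t : ℕ → ℚ≥0`. -/
def GenSet : Set RZero :=
  { x | (∃ α : ℚ≥0, x = AddMonoidAlgebra.single (α, 0, 0, 0) 1)
      ∨ (∃ α : ℚ≥0, x = AddMonoidAlgebra.single (0, α, 0, 0) 1)
      ∨ (∃ α : ℚ≥0, x = AddMonoidAlgebra.single (0, 0, α, 0) 1)
      ∨ (∃ (α : ℚ≥0) (t : ℕ → ℚ≥0), 0 < α ∧ x = AddMonoidAlgebra.single (α, 0, 0, t) 1)
      ∨ (∃ (α : ℚ≥0) (t : ℕ → ℚ≥0), 0 < α ∧ x = AddMonoidAlgebra.single (0, α, 0, t) 1)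
      ∨ (∃ (α : ℚ≥0) (t : ℕ → ℚ≥0), 0 < α ∧ x = AddMonoidAlgebra.single (0, 0, α, t) 1) }

/-- The subalgebra `R` of `R₀` generated by `GenSet`. -/
noncomputable def RSub : Subalgebra (ZMod 2) RZero := Algebra.adjoin (ZMod 2) GenSet

/-- `D` is an IDF domain if every nonzero element of `D` has only finitely many
irreducible divisors up to associates. -/
def IsIDFDomain (D : Type*) [CommRing D] : Prop :=
  ∀ a : D, a ≠ 0 → ∃ S : Finset D, (∀ s ∈ S, Irreducible s) ∧
    ∀ d : D, Irreducible d → d ∣ a → ∃ s ∈ S, Associated d s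

open AddMonoidAlgebra in
/-- Over a monoid with two unique sums, a divisor of a monomial is a monomial. -/
theorem exists_eq_single_of_mul_eq_single {k G : Type*} [Semiring k] [NoZeroDivisors k]
    [Add G] [TwoUniqueSums G] {p q : AddMonoidAlgebra k G} {m : G} {r : k} (hr : r ≠ 0)
    (h : p * q = single m r) :
    ∃ a b : G, ∃ u v : k, p = single a u ∧ q = single b v ∧ a + b = m ∧ u * v = r := by
  classical
  have hne : p * q ≠ 0 := by
    rw [h]
    intro h0
    exact hr (by simpa using congrArg (fun f => f.coeff m) h0)
  have key : ∀ z ∈ p.coeff.support ×ˢ q.coeff.support,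
      UniqueAdd p.coeff.support q.coeff.support z.1 z.2 → z.1 + z.2 = m := by
    intro z hz hu
    by_contra hm
    have h1 := coeff_mul_add_of_uniqueAdd hu
    rw [h, coeff_single, Finsupp.single_eq_of_ne hm] at h1
    simp only [Finset.mem_product, Finsupp.mem_support_iff] at hz
    exact mul_ne_zero hz.1 hz.2 h1.symm
  have hcard : ¬ 1 < p.coeff.support.card * q.coeff.support.card := by
    intro hc
    obtain ⟨z, hz, w, hw, hzw, hu, hv⟩ := TwoUniqueSums.uniqueAdd_of_one_lt_card hc
    simp only [Finset.mem_product] at hw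
    obtain ⟨h1, h2⟩ := hu hw.1 hw.2 ((key w (by simpa using hw) hv).trans (key z hz hu).symm)
    exact hzw (Prod.ext h1.symm h2.symm)
  have hp : p.coeff.support.card ≠ 0 := by
    intro h0
    apply left_ne_zero_of_mul hne
    ext i
    simp [Finsupp.support_eq_empty.1 (Finset.card_eq_zero.1 h0)]
  have hq : q.coeff.support.card ≠ 0 := by
    intro h0
    apply right_ne_zero_of_mul hne
    ext i
    simp [Finsupp.support_eq_empty.1 (Finset.card_eq_zero.1 h0)]
  have hpq : p.coeff.support.card * q.coeff.support.card = 1 :=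
    le_antisymm (not_lt.1 hcard) (Nat.one_le_iff_ne_zero.2 (mul_ne_zero hp hq))
  obtain ⟨hp1, hq1⟩ := mul_eq_one.1 hpq
  obtain ⟨a, u, -, hpa⟩ := Finsupp.card_support_eq_one'.1 hp1
  obtain ⟨b, v, -, hqb⟩ := Finsupp.card_support_eq_one'.1 hq1
  have hp' : p = single a u := by ext i; simp [hpa]
  have hq' : q = single b v := by ext i; simp [hqb]
  have h' := h
  rw [hp', hq', single_mul_single] at h'
  have h2 := congrArg coeff h'
  rw [coeff_single, coeff_single, Finsupp.single_eq_single_iff] at h2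
  refine ⟨a, b, u, v, hp', hq', ?_⟩
  rcases h2 with h2 | h2
  · exact h2
  · exact absurd h2.2 hr

/-- A monomial occurring in an element of `RSub` involves the `T_i` only if it involves one of
`X`, `Y`, `Z`. -/
theorem snd_snd_snd_eq_zero_of_mem_RSub {f : RZero} (hf : f ∈ RSub) :
    ∀ m : ExpMonoid, f.coeff m ≠ 0 → m.1 = 0 → m.2.1 = 0 → m.2.2.1 = 0 → m.2.2.2 = 0 := by
  classical
  induction hf using Algebra.adjoin_induction with
  | mem x hx =>
    intro m hm h1 h2 h3
    obtain ⟨α, rfl⟩ | ⟨α, rfl⟩ | ⟨α, rfl⟩ | ⟨α, t, hα, rfl⟩ | ⟨α, t, hα, rfl⟩ | ⟨α, t, hα, rfl⟩ := hx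
    all_goals
      rw [AddMonoidAlgebra.coeff_single, Finsupp.single_apply_ne_zero] at hm
      obtain ⟨rfl, -⟩ := hm
      simp_all
  | algebraMap r =>
    intro m hm _ _ _
    rw [AddMonoidAlgebra.coe_algebraMap, Function.comp_apply, AddMonoidAlgebra.coeff_single,
      Finsupp.single_apply_ne_zero] at hm
    simp [hm.1]
  | add x y _ _ hx hy =>
    intro m hm
    by_cases h : x.coeff m = 0
    · exact hy m (by simpa [h] using hm)
    · exact hx m h
  | mul x y _ _ hx hy =>
    intro m hm h1 h2 h3
    obtain ⟨a, ha, b, hb, rfl⟩ := Finset.mem_add.1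
      (AddMonoidAlgebra.support_coeff_mul_subset x y (Finsupp.mem_support_iff.2 hm))
    simp only [Prod.fst_add, Prod.snd_add, add_eq_zero] at h1 h2 h3
    rw [Prod.snd_add, Prod.snd_add, Prod.snd_add, hx a (Finsupp.mem_support_iff.1 ha) h1.1 h2.1 h3.1,
      hy b (Finsupp.mem_support_iff.1 hb) h1.2 h2.2 h3.2, add_zero]

instance : TwoUniqueSums ExpMonoid :=
  have : TwoUniqueSums (ℚ≥0 × (ℕ → ℚ≥0)) := inferInstance
  have : TwoUniqueSums (ℚ≥0 × ℚ≥0 × (ℕ → ℚ≥0)) := inferInstance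
  inferInstanceAs (TwoUniqueSums (ℚ≥0 × ℚ≥0 × ℚ≥0 × (ℕ → ℚ≥0)))

/-- The monomial `X ∏_i T_i^(t i)` of `RSub`. -/
noncomputable def monomialX (t : ℕ → ℚ≥0) : RSub :=
  ⟨AddMonoidAlgebra.single (1, 0, 0, t) 1,
    Algebra.subset_adjoin (Or.inr (Or.inr (Or.inr (Or.inl ⟨1, t, one_pos, rfl⟩))))⟩

/-- The monomial `Y ∏_i T_i^(t i)` of `RSub`. -/
noncomputable def monomialY (t : ℕ → ℚ≥0) : RSub :=
  ⟨AddMonoidAlgebra.single (0, 1, 0, t) 1,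
    Algebra.subset_adjoin (Or.inr (Or.inr (Or.inr (Or.inr (Or.inl ⟨1, t, one_pos, rfl⟩)))))⟩

theorem monomialX_injective : Function.Injective monomialX := by
  intro s t h
  have h1 := congrArg (fun f : RSub => (f : RZero).coeff) h
  simp only [monomialX, AddMonoidAlgebra.coeff_single] at h1
  simpa using Finsupp.single_left_injective one_ne_zero h1

theorem monomialX_ne_zero (t : ℕ → ℚ≥0) : monomialX t ≠ 0 := by
  intro h
  have h1 := congrArg (fun f : RSub => (f : RZero).coeff (1, 0, 0, t)) h
  simp [monomialX] at h1

theorem monomialX_mul_monomialX (a b c d : ℕ → ℚ≥0) (h : a + b = c + d) :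
    monomialX a * monomialX b = monomialX c * monomialX d := by
  apply Subtype.ext
  simp [monomialX, AddMonoidAlgebra.single_mul_single, h]

theorem monomialX_mul_monomialY (a b c d : ℕ → ℚ≥0) (h : a + b = c + d) :
    monomialX a * monomialY b = monomialX c * monomialY d := by
  apply Subtype.ext
  simp [monomialX, monomialY, AddMonoidAlgebra.single_mul_single, h]

/-- The only common divisor of `X ∏_i T_i^(t i)` and `Y ∏_i T_i^(t i)` in `RSub` is `1`. -/
theorem eq_one_of_dvd_monomialX_of_dvd_monomialY {t : ℕ → ℚ≥0} {c : RSub}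
    (hx : c ∣ monomialX t) (hy : c ∣ monomialY t) : c = 1 := by
  obtain ⟨d, hd⟩ := hx
  obtain ⟨e, he⟩ := hy
  obtain ⟨a, b, u, v, hc, -, hab, huv⟩ := exists_eq_single_of_mul_eq_single one_ne_zero
    (congrArg Subtype.val hd).symm
  obtain ⟨a', b', u', v', hc', -, hab', -⟩ := exists_eq_single_of_mul_eq_single one_ne_zero
    (congrArg Subtype.val he).symm
  have hu0 : u ≠ 0 := left_ne_zero_of_mul (huv ▸ one_ne_zero)
  have hu : u = 1 := (by decide : ∀ w : ZMod 2, w ≠ 0 → w = 1) u hu0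
  have haa : a = a' := by
    have h1 := congrArg AddMonoidAlgebra.coeff (hc.symm.trans hc')
    rw [AddMonoidAlgebra.coeff_single, AddMonoidAlgebra.coeff_single,
      Finsupp.single_eq_single_iff] at h1
    rcases h1 with h1 | h1
    · exact h1.1
    · exact absurd h1.1 hu0
  subst haa
  have hm := snd_snd_snd_eq_zero_of_mem_RSub c.2 a (by simpa [hc] using hu0)
  simp only [Prod.ext_iff, Prod.fst_add, Prod.snd_add, add_eq_zero] at hab hab'
  have ha : a = 0 := Prod.ext hab'.1.1 (Prod.ext hab.2.1.1 (Prod.ext hab.2.2.1.1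
    (hm hab'.1.1 hab.2.1.1 hab.2.2.1.1)))
  apply Subtype.ext
  rw [hc, ha, hu]
  rfl

theorem eq_one_of_isUnit_RSub {c : RSub} (hc : IsUnit c) : c = 1 :=
  eq_one_of_dvd_monomialX_of_dvd_monomialY (t := 0) hc.dvd hc.dvd

instance : NoZeroDivisors RSub :=
  Function.Injective.noZeroDivisors (Subtype.val : RSub → RZero) Subtype.val_injective rfl
    fun _ _ => rfl

instance : IsDomain RSub := NoZeroDivisors.to_isDomain RSub

open Polynomial in
/-- A linear polynomial whose coefficients have only unit common divisors is irreducible. -/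
theorem irreducible_C_mul_X_add_C_of_dvd {A : Type*} [CommRing A] [IsDomain A] {a b : A}
    (ha : a ≠ 0) (h : ∀ c, c ∣ a → c ∣ b → IsUnit c) : Irreducible (C a * X + C b) := by
  have hdeg := natDegree_linear (b := b) ha
  have h0 : C a * X + C b ≠ 0 := ne_zero_of_natDegree_gt (n := 0) (by omega)
  have key : ∀ p q : A[X], C a * X + C b = p * q → p.natDegree = 0 → IsUnit p := by
    intro p q hpq hp
    rw [eq_C_of_natDegree_eq_zero hp] at hpq ⊢
    refine (h _ ⟨q.coeff 1, ?_⟩ ⟨q.coeff 0, ?_⟩).map C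
    · simpa using congrArg (fun f => f.coeff 1) hpq
    · simpa using congrArg (fun f => f.coeff 0) hpq
  refine ⟨fun hu => ?_, fun p q hpq => ?_⟩
  · rw [natDegree_eq_zero_of_isUnit hu] at hdeg
    exact zero_ne_one hdeg
  · have hp0 : p ≠ 0 := left_ne_zero_of_mul (hpq ▸ h0)
    have hq0 : q ≠ 0 := right_ne_zero_of_mul (hpq ▸ h0)
    have hadd := natDegree_mul hp0 hq0
    rw [← hpq, hdeg] at hadd
    rcases Nat.eq_zero_or_pos p.natDegree with hp | hp
    · exact Or.inl (key p q hpq hp)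
    · exact Or.inr (key q p (hpq.trans (mul_comm p q)) (by omega))

/-- The linear polynomial `(∏_i T_i^(t i)) (X x + Y)` in `RSub[x]`. -/
noncomputable def linearPoly (t : ℕ → ℚ≥0) : Polynomial RSub :=
  Polynomial.C (monomialX t) * Polynomial.X + Polynomial.C (monomialY t)

theorem irreducible_linearPoly (t : ℕ → ℚ≥0) : Irreducible (linearPoly t) :=
  irreducible_C_mul_X_add_C_of_dvd (monomialX_ne_zero t) fun _ hx hy =>
    eq_one_of_dvd_monomialX_of_dvd_monomialY hx hy ▸ isUnit_one

theorem linearPoly_dvd {s t : ℕ → ℚ≥0} (h : s ≤ t) :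
    linearPoly s ∣ Polynomial.C (monomialX t) * linearPoly 0 := by
  obtain ⟨r, rfl⟩ := exists_add_of_le h
  refine ⟨Polynomial.C (monomialX r), ?_⟩
  have h1 := monomialX_mul_monomialX (s + r) 0 r s (by rw [add_zero, add_comm])
  have h2 := monomialX_mul_monomialY (s + r) 0 r s (by rw [add_zero, add_comm])
  rw [mul_comm (linearPoly s)]
  simp only [linearPoly, mul_add, ← mul_assoc, ← Polynomial.C_mul, h1, h2]

theorem eq_of_associated_linearPoly {s t : ℕ → ℚ≥0} (h : Associated (linearPoly s) (linearPoly t)) :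
    s = t := by
  obtain ⟨u, hu⟩ := h
  obtain ⟨r, hr, hru⟩ := Polynomial.isUnit_iff.1 u.isUnit
  rw [← hru, eq_one_of_isUnit_RSub hr, map_one, mul_one] at hu
  apply monomialX_injective
  simpa [linearPoly] using congrArg (fun f => f.coeff 1) hu

/-- The polynomial ring `R[x]` is not an IDF domain. -/
theorem stmt17 : ¬ IsIDFDomain (Polynomial ↥RSub) := by
  intro h
  obtain ⟨S, -, hS⟩ := h (Polynomial.C (monomialX 1) * linearPoly 0)
    (mul_ne_zero (Polynomial.C_ne_zero.2 (monomialX_ne_zero 1)) (irreducible_linearPoly 0).ne_zero)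
  have hle : ∀ n : ℕ, (Pi.single n 1 : ℕ → ℚ≥0) ≤ 1 := by
    intro n i
    obtain rfl | h := eq_or_ne i n <;> simp [*]
  choose g hgS hg using fun n : ℕ =>
    hS (linearPoly (Pi.single n 1)) (irreducible_linearPoly _) (linearPoly_dvd (hle n))
  obtain ⟨m, n, hmn, hgmn⟩ := Finite.exists_ne_map_eq_of_infinite
    fun n => (⟨g n, hgS n⟩ : S)
  have hassoc := (hg m).trans ((Subtype.mk.inj hgmn) ▸ (hg n).symm)
  have heq := congrFun (eq_of_associated_linearPoly hassoc) m
  simp [hmn] at heq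
end
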